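/- There exists ε₀ > 0, depending only on S and k, such that for every plain k-fission H of S within any ε ≤ ε₀ the following holds: for every point v of S, every point x of the v-cluster, and every point w of S with w ≠ v, the point x is an endpoint of exactly one halving edge of H whose other endpoint lies in the w-cluster if {v,w} is a halving edge of S, and x is an endpoint of no such halving edge otherwise. -/

import Mathlib

noncomputable section

/-- The plane. -/
abbrev Pt : Type := EuclideanSpace ℝ (Fin 2)

/-- Signed determinant of the triple `(p, q, r)`: positive iff `r` lies on the left of
the directed line from `p` to `q`. -/
def det2 (p q r : Pt) : ℝ :=
  (q 0 - p 0) * (r 1 - p 1) - (q 1 - p 1) * (r 0 - p 0)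

/-- A finite set of points in the plane is in general position if no three of its
(distinct) points are collinear. -/
def GenPos (S : Finset Pt) : Prop :=
  ∀ p ∈ S, ∀ q ∈ S, ∀ r ∈ S, p ≠ q → p ≠ r → q ≠ r →
    ¬ Collinear ℝ ({p, q, r} : Set Pt)

/-- `{p, q}` is a halving edge of `S`: `p, q` are distinct points of `S` and the open
half-planes on the two sides of the line through `p` and `q` each contain exactly
`(|S| - 2)/2` points of `S`. -/
def HalvingEdge (S : Finset Pt) (p q : Pt) : Prop :=
  p ∈ S ∧ q ∈ S ∧ p ≠ q ∧
    {r ∈ (S : Set Pt) | 0 < det2 p q r}.ncard = (S.card - 2) / 2 ∧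
    {r ∈ (S : Set Pt) | det2 p q r < 0}.ncard = (S.card - 2) / 2

/-- The halving edges graph of `S` (as a graph on the whole plane; all vertices
outside `S` are isolated). -/
def halvingGraph (S : Finset Pt) : SimpleGraph Pt :=
  SimpleGraph.fromRel (HalvingEdge S)

/-- The number of halving edges of `S`. -/
def halvingEdgeCount (S : Finset Pt) : ℕ :=
  {e : Sym2 Pt | ∃ p q, e = s(p, q) ∧ HalvingEdge S p q}.ncard

/-- `H`, together with the cluster map `cl`, is a `k`-fission of `S` within `ε`:
`H` is a set of `k * |S|` points in general position partitioned into clusters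
`cl v` of `k` points, one for each `v ∈ S`, with each point of the `v`-cluster
within distance `ε` of `v`. -/
structure IsFission (S : Finset Pt) (k : ℕ) (ε : ℝ) (H : Finset Pt)
    (cl : Pt → Finset Pt) : Prop where
  genPos : GenPos H
  cluster_card : ∀ v ∈ S, (cl v).card = k
  disj : ∀ v ∈ S, ∀ w ∈ S, v ≠ w → Disjoint (cl v) (cl w)
  union_eq : (H : Set Pt) = ⋃ v ∈ S, (cl v : Set Pt)
  close : ∀ v ∈ S, ∀ x ∈ cl v, dist x v ≤ ε

/-- A fission is plain if no halving edge of `H` has both endpoints in the same cluster. -/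
def IsPlain (S : Finset Pt) (H : Finset Pt) (cl : Pt → Finset Pt) : Prop :=
  ∀ v ∈ S, ∀ p ∈ cl v, ∀ q ∈ cl v, ¬ HalvingEdge H p q

local instance : DecidableEq Pt := Classical.decEq _

open Filter Topology

/-- The number of indices in `F` where `f` is positive minus the number where it is negative. -/
def signSum {ι : Type*} (F : Finset ι) (f : ι → ℝ) : ℤ :=
  ∑ s ∈ F, (SignType.sign (f s) : ℤ)

theorem abs_sign_le_one (r : ℝ) : |((SignType.sign r : SignType) : ℤ)| ≤ 1 := by
  rcases lt_trichotomy r 0 with h | h | h <;> simp [h]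

theorem abs_signSum_le_card {ι : Type*} (F : Finset ι) (f : ι → ℝ) :
    |signSum F f| ≤ F.card := by
  refine (Finset.abs_sum_le_sum_abs _ _).trans ?_
  simpa using Finset.sum_le_sum fun s (_ : s ∈ F) => abs_sign_le_one (f s)

theorem signSum_congr {ι : Type*} {F : Finset ι} {f g : ι → ℝ}
    (h : ∀ s ∈ F, SignType.sign (f s) = SignType.sign (g s)) : signSum F f = signSum F g :=
  Finset.sum_congr rfl fun s hs => by rw [h s hs]

theorem signSum_of_pos {ι : Type*} {F : Finset ι} {f : ι → ℝ} (h : ∀ s ∈ F, 0 < f s) :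
    signSum F f = F.card := by
  rw [signSum, Finset.sum_congr rfl fun s hs => by rw [sign_pos (h s hs)]]
  simp

theorem signSum_of_neg {ι : Type*} {F : Finset ι} {f : ι → ℝ} (h : ∀ s ∈ F, f s < 0) :
    signSum F f = -F.card := by
  rw [signSum, Finset.sum_congr rfl fun s hs => by rw [sign_neg (h s hs)]]
  simp

theorem signSum_erase {ι : Type*} [DecidableEq ι] {F : Finset ι} {f : ι → ℝ} {x : ι}
    (h : f x = 0) : signSum (F.erase x) f = signSum F f :=
  Finset.sum_erase _ (by simp [h])

/-- A sum of signs of nonzero numbers has the parity of the number of terms. -/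
theorem even_signSum_iff {ι : Type*} {F : Finset ι} {f : ι → ℝ} (h : ∀ s ∈ F, f s ≠ 0) :
    Even (signSum F f) ↔ Even F.card := by
  have key : Even (signSum F f - F.card) := by
    rw [signSum, Finset.cast_card, ← Finset.sum_sub_distrib]
    refine Finset.even_sum _ fun s hs => ?_
    rcases (h s hs).lt_or_gt with h | h
    · rw [sign_neg h]; decide
    · rw [sign_pos h]; decide
  rw [Int.even_sub] at key
  rw [key, Int.even_coe_nat]

/-- The signs of finitely many affine functions that do not vanish at `t₀` are constant
near `t₀`. -/
theorem eventually_signSum_eq {ι : Type*} {F : Finset ι} {a b : ι → ℝ} {t₀ : ℝ}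
    (h : ∀ s ∈ F, a s - t₀ * b s ≠ 0) :
    ∀ᶠ t in 𝓝 t₀, signSum F (fun s => a s - t * b s) = signSum F (fun s => a s - t₀ * b s) := by
  have : ∀ᶠ t in 𝓝 t₀, ∀ s ∈ F,
      SignType.sign (a s - t * b s) = SignType.sign (a s - t₀ * b s) := by
    rw [eventually_all_finset]
    intro s hs
    have hc : ContinuousAt (fun t : ℝ => SignType.sign (a s - t * b s)) t₀ :=
      ContinuousAt.comp (f := fun t : ℝ => a s - t * b s)
        (continuousAt_sign_of_ne_zero (h s hs)) (by fun_prop)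
    exact hc.eventually ((isOpen_discrete {SignType.sign (a s - t₀ * b s)}).mem_nhds rfl)
  exact this.mono fun t ht => signSum_congr ht

/-- A family of affine functions `t ↦ a s - t * b s`, odd in number, no two of which vanish
at the same parameter, and none of which is identically zero. -/
structure IsPencil {ι : Type*} (F : Finset ι) (a b : ι → ℝ) : Prop where
  odd_card : Odd F.card
  ne_zero : ∀ s ∈ F, a s ≠ 0 ∨ b s ≠ 0
  det_ne_zero : ∀ s ∈ F, ∀ r ∈ F, s ≠ r → a s * b r - a r * b s ≠ 0

namespace IsPencil

variable {ι : Type*} {F : Finset ι} {a b : ι → ℝ} {t₀ : ℝ}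

theorem eventually_eq_of_forall_ne (hF : IsPencil F a b) (h : ∀ s ∈ F, a s - t₀ * b s ≠ 0) :
    signSum F (fun s => a s - t₀ * b s) ≠ 0 ∧ ∀ᶠ t in 𝓝 t₀,
      signSum F (fun s => a s - t * b s) = signSum F (fun s => a s - t₀ * b s) := by
  refine ⟨fun h0 => ?_, eventually_signSum_eq h⟩
  have := (even_signSum_iff h).1 (h0 ▸ Even.zero)
  exact (Nat.not_even_iff_odd.2 hF.odd_card) this

theorem eventually_eq_of_eq_zero (hF : IsPencil F a b) {s : ι} (hs : s ∈ F)
    (h : a s - t₀ * b s = 0) :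
    b s ≠ 0 ∧ Even (signSum F fun s => a s - t₀ * b s) ∧ ∀ᶠ t in 𝓝 t₀,
      signSum F (fun s => a s - t * b s) =
        signSum F (fun s => a s - t₀ * b s) + SignType.sign ((t₀ - t) * b s) := by
  classical
  have hb : b s ≠ 0 := by
    intro hb
    rcases hF.ne_zero s hs with h1 | h1
    · exact h1 (by simpa [hb] using h)
    · exact h1 hb
  have hne : ∀ r ∈ F.erase s, a r - t₀ * b r ≠ 0 := by
    intro r hr h1
    rw [Finset.mem_erase] at hr
    refine hF.det_ne_zero s hs r hr.2 hr.1.symm ?_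
    linear_combination b r * h - b s * h1
  have herase := signSum_erase (F := F) (f := fun s => a s - t₀ * b s) h
  refine ⟨hb, ?_, ?_⟩
  · rw [← herase, even_signSum_iff hne, Finset.card_erase_of_mem hs]
    exact hF.odd_card.tsub_odd odd_one
  · filter_upwards [eventually_signSum_eq hne] with t ht
    rw [← herase, ← ht, signSum, ← Finset.sum_erase_add _ _ hs]
    rw [signSum, show a s - t * b s = (t₀ - t) * b s by linear_combination h]

theorem exists_eq_zero (hF : IsPencil F a b)
    (h0 : signSum F (fun s => a s - t₀ * b s) = 0) : ∃ s ∈ F, a s - t₀ * b s = 0 := by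
  by_contra! h
  exact (hF.eventually_eq_of_forall_ne h).1 h0

theorem eventually_pos (hF : IsPencil F a b) (h0 : 0 < signSum F fun s => a s - t₀ * b s) :
    ∀ᶠ t in 𝓝 t₀, 0 < signSum F fun s => a s - t * b s := by
  by_cases h : ∀ s ∈ F, a s - t₀ * b s ≠ 0
  · filter_upwards [(hF.eventually_eq_of_forall_ne h).2] with t ht
    rwa [ht]
  · push Not at h
    obtain ⟨s, hs, h⟩ := h
    obtain ⟨-, he, hev⟩ := hF.eventually_eq_of_eq_zero hs h
    filter_upwards [hev] with t ht
    have := abs_le.1 (abs_sign_le_one ((t₀ - t) * b s))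
    obtain ⟨m, hm⟩ := he
    omega

theorem eventually_neg (hF : IsPencil F a b) (h0 : signSum F (fun s => a s - t₀ * b s) < 0) :
    ∀ᶠ t in 𝓝 t₀, signSum F (fun s => a s - t * b s) < 0 := by
  by_cases h : ∀ s ∈ F, a s - t₀ * b s ≠ 0
  · filter_upwards [(hF.eventually_eq_of_forall_ne h).2] with t ht
    rwa [ht]
  · push Not at h
    obtain ⟨s, hs, h⟩ := h
    obtain ⟨-, he, hev⟩ := hF.eventually_eq_of_eq_zero hs h
    filter_upwards [hev] with t ht
    have := abs_le.1 (abs_sign_le_one ((t₀ - t) * b s))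
    obtain ⟨m, hm⟩ := he
    omega

/-- At a zero of the sign sum caused by a decreasing member of the family, the sign sum
changes from positive to negative. -/
theorem eventually_sign_change (hF : IsPencil F a b) {s : ι} (hs : s ∈ F)
    (h : a s - t₀ * b s = 0) (hb : 0 < b s)
    (h0 : signSum F (fun s => a s - t₀ * b s) = 0) :
    ∀ᶠ t in 𝓝 t₀, (t < t₀ → 0 < signSum F fun s => a s - t * b s) ∧
      (t₀ < t → signSum F (fun s => a s - t * b s) < 0) := by
  filter_upwards [(hF.eventually_eq_of_eq_zero hs h).2.2] with t ht
  rw [ht, h0]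
  constructor
  · intro hlt
    rw [sign_pos (mul_pos (sub_pos.2 hlt) hb)]
    decide
  · intro hlt
    rw [sign_neg (mul_neg_of_neg_of_pos (sub_neg.2 hlt) hb)]
    decide

theorem exists_signSum_eq_zero (hF : IsPencil F a b) {c d : ℝ} (hcd : c ≤ d)
    (hc : 0 < signSum F fun s => a s - c * b s) (hd : signSum F (fun s => a s - d * b s) < 0) :
    ∃ t ∈ Set.Icc c d, signSum F (fun s => a s - t * b s) = 0 := by
  by_contra! hne
  have hclosed : IsClosed {t | 0 ≤ signSum F fun s => a s - t * b s} := by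
    rw [← isOpen_compl_iff, isOpen_iff_mem_nhds]
    intro t ht
    filter_upwards [hF.eventually_neg (not_le.1 ht)] with r hr using not_le.2 hr
  refine absurd hd (not_lt.2 ((hclosed.inter isClosed_Icc).Icc_subset_of_forall_exists_gt
    hc.le ?_ ⟨hcd, le_rfl⟩))
  rintro t ⟨ht, htcd⟩ y hy
  have hpos := lt_of_le_of_ne ht (hne t (Set.Ico_subset_Icc_self htcd)).symm
  obtain ⟨r, hr, hry⟩ := (((hF.eventually_pos hpos).filter_mono nhdsWithin_le_nhds).and
    (Ioc_mem_nhdsGT hy)).exists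
  exact ⟨r, hr.le, hry⟩

/-- If zeros of the sign sum are only caused by decreasing members of the family, then there
is at most one of them. -/
theorem not_lt_of_signSum_eq_zero (hF : IsPencil F a b) {c d : ℝ}
    (hdec : ∀ t ∈ Set.Icc c d, signSum F (fun s => a s - t * b s) = 0 →
      ∃ s ∈ F, a s - t * b s = 0 ∧ 0 < b s)
    (hc : signSum F (fun s => a s - c * b s) = 0) (hd : signSum F (fun s => a s - d * b s) = 0) :
    ¬ c < d := by
  intro hcd
  have hclosed : IsClosed {t | signSum F (fun s => a s - t * b s) ≤ 0} := by
    rw [← isOpen_compl_iff, isOpen_iff_mem_nhds]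
    intro t ht
    filter_upwards [hF.eventually_pos (not_le.1 ht)] with r hr using not_le.2 hr
  have hsub := (hclosed.inter isClosed_Icc).Icc_subset_of_forall_exists_gt (a := c) (b := d)
    hc.le (by
      rintro t ⟨ht, htcd⟩ y hy
      have hneg : ∀ᶠ r in 𝓝[>] t, signSum F (fun s => a s - r * b s) < 0 := by
        rcases (show signSum F (fun s => a s - t * b s) ≤ 0 from ht).lt_or_eq with h | h
        · exact (hF.eventually_neg h).filter_mono nhdsWithin_le_nhds
        · obtain ⟨s, hs, h1, h2⟩ := hdec t (Set.Ico_subset_Icc_self htcd) h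
          filter_upwards [(hF.eventually_sign_change hs h1 h2 h).filter_mono nhdsWithin_le_nhds,
            self_mem_nhdsWithin] with r hr hr' using hr.2 hr'
      obtain ⟨r, hr, hry⟩ := (hneg.and (Ioc_mem_nhdsGT hy)).exists
      exact ⟨r, hr.le, hry⟩)
  obtain ⟨s, hs, h1, h2⟩ := hdec d ⟨hcd.le, le_rfl⟩ hd
  obtain ⟨r, hr, hrcd, hrd⟩ :=
    (((hF.eventually_sign_change hs h1 h2 hd).filter_mono nhdsWithin_le_nhds).and
      (Ioo_mem_nhdsLT hcd)).exists
  exact absurd (hr.1 hrd) (not_lt.2 (hsub ⟨hrcd.le, hrd.le⟩))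

end IsPencil

theorem signSum_const_mul {ι : Type*} (F : Finset ι) (c : ℝ) (f : ι → ℝ) :
    signSum F (fun s => c * f s) = SignType.sign c * signSum F f := by
  simp only [signSum, sign_mul, SignType.coe_mul, Finset.mul_sum]

theorem signSum_eq_card_sub_card {ι : Type*} (F : Finset ι) (f : ι → ℝ) :
    signSum F f = (F.filter (0 < f ·)).card - (F.filter (f · < 0)).card := by
  rw [Finset.card_filter, Finset.card_filter, signSum]
  push_cast
  rw [← Finset.sum_sub_distrib]
  refine Finset.sum_congr rfl fun s _ => ?_
  rcases lt_trichotomy (f s) 0 with h | h | h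
  · simp [h, h.not_gt]
  · simp [h]
  · simp [h, h.not_gt]

theorem det2_self_left (p q : Pt) : det2 p q p = 0 := by simp [det2]

theorem det2_self_right (p q : Pt) : det2 p q q = 0 := by
  simp only [det2]; ring

/-- The square of the distance from `v` to `w`, in coordinates. -/
theorem sq_add_sq_pos {v w : Pt} (h : v ≠ w) :
    0 < (w 0 - v 0) * (w 0 - v 0) + (w 1 - v 1) * (w 1 - v 1) := by
  by_contra! hle
  refine h ?_
  have h0 : w 0 - v 0 = 0 := by nlinarith [mul_self_nonneg (w 1 - v 1), mul_self_nonneg (w 0 - v 0)]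
  have h1 : w 1 - v 1 = 0 := by nlinarith [mul_self_nonneg (w 1 - v 1), mul_self_nonneg (w 0 - v 0)]
  ext i
  fin_cases i
  · exact (sub_eq_zero.1 h0).symm
  · exact (sub_eq_zero.1 h1).symm

theorem collinear_of_det2_eq_zero {p q r : Pt} (hpq : p ≠ q) (h : det2 p q r = 0) :
    Collinear ℝ ({p, q, r} : Set Pt) := by
  have hpos := sq_add_sq_pos hpq
  set n := (q 0 - p 0) * (q 0 - p 0) + (q 1 - p 1) * (q 1 - p 1) with hn
  rw [collinear_iff_of_mem (p₀ := p) (by simp)]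
  refine ⟨q - p, ?_⟩
  rintro x (rfl | rfl | rfl)
  · exact ⟨0, by simp⟩
  · exact ⟨1, by simp⟩
  · refine ⟨((q 0 - p 0) * (x 0 - p 0) + (q 1 - p 1) * (x 1 - p 1)) / n, ?_⟩
    rw [det2] at h
    ext i
    fin_cases i
    · simp
      field_simp
      rw [hn]
      linear_combination (-(q 1 - p 1)) * h
    · simp
      field_simp
      rw [hn]
      linear_combination (q 0 - p 0) * h

theorem GenPos.det2_ne_zero {S : Finset Pt} (hS : GenPos S) {p q r : Pt} (hp : p ∈ S)
    (hq : q ∈ S) (hr : r ∈ S) (hpq : p ≠ q) (hpr : p ≠ r) (hqr : q ≠ r) : det2 p q r ≠ 0 :=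
  fun h => hS p hp q hq r hr hpq hpr hqr (collinear_of_det2_eq_zero hpq h)

/-- In general position, the balance of the points around a line through two of them is even. -/
theorem GenPos.even_signSum {S : Finset Pt} (hS : GenPos S) (hcard : Even S.card) {p q : Pt}
    (hp : p ∈ S) (hq : q ∈ S) (hpq : p ≠ q) : Even (signSum S (det2 p q)) := by
  have hq' : q ∈ S.erase p := Finset.mem_erase.2 ⟨hpq.symm, hq⟩
  rw [← signSum_erase (det2_self_left p q), ← signSum_erase (det2_self_right p q),
    even_signSum_iff, Finset.card_erase_of_mem hq', Finset.card_erase_of_mem hp]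
  · obtain ⟨m, hm⟩ := hcard
    exact ⟨m - 1, by omega⟩
  · intro r hr
    simp only [Finset.mem_erase] at hr
    exact hS.det2_ne_zero hp hq hr.2.2 hpq (Ne.symm hr.2.1) (Ne.symm hr.1)

theorem GenPos.halvingEdge_iff {S : Finset Pt} (hS : GenPos S) (hcard : Even S.card) {p q : Pt}
    (hp : p ∈ S) (hq : q ∈ S) (hpq : p ≠ q) :
    HalvingEdge S p q ↔ signSum S (det2 p q) = 0 := by
  have hcoe : ∀ P : Pt → Prop, [DecidablePred P] →
      {r ∈ (S : Set Pt) | P r}.ncard = (S.filter P).card := by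
    intro P _
    rw [← Set.ncard_coe_finset, Finset.coe_filter]
    rfl
  have hzero : (S.filter (det2 p q · = 0)) = {p, q} := by
    ext r
    simp only [Finset.mem_filter, Finset.mem_insert, Finset.mem_singleton]
    constructor
    · rintro ⟨hr, h⟩
      by_contra! hne
      exact hS.det2_ne_zero hp hq hr hpq hne.1.symm hne.2.symm h
    · rintro (rfl | rfl)
      · exact ⟨hp, det2_self_left _ _⟩
      · exact ⟨hq, det2_self_right _ _⟩
  have htotal : S.card =
      (S.filter (0 < det2 p q ·)).card + (S.filter (det2 p q · < 0)).card + 2 := by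
    have h1 : (S.filter (det2 p q · = 0)).card = 2 := by rw [hzero, Finset.card_pair hpq]
    rw [← h1, Finset.card_filter, Finset.card_filter, Finset.card_filter,
      ← Finset.sum_add_distrib, ← Finset.sum_add_distrib, Finset.card_eq_sum_ones]
    refine Finset.sum_congr rfl fun s _ => ?_
    rcases lt_trichotomy (det2 p q s) 0 with h | h | h
    · simp [h, h.ne, h.not_gt]
    · simp [h]
    · simp [h, h.ne', h.not_gt]
  rw [signSum_eq_card_sub_card, HalvingEdge, hcoe, hcoe]
  obtain ⟨m, hm⟩ := hcard
  constructor
  · rintro ⟨-, -, -, h1, h2⟩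
    omega
  · intro h
    exact ⟨hp, hq, hpq, by omega, by omega⟩

/-- The cross product of `w - v` and `s - x`. -/
def cross (v w x s : Pt) : ℝ :=
  (w 0 - v 0) * (s 1 - x 1) - (w 1 - v 1) * (s 0 - x 0)

/-- The dot product of `w - v` and `s - x`. -/
def dot (v w x s : Pt) : ℝ :=
  (w 0 - v 0) * (s 0 - x 0) + (w 1 - v 1) * (s 1 - x 1)

theorem cross_left_eq_det2 (v w u : Pt) : cross v w v u = det2 v w u := rfl

theorem cross_point_self (v w x : Pt) : cross v w x x = 0 := by simp [cross]

theorem dot_point_self (v w x : Pt) : dot v w x x = 0 := by simp [dot]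

theorem dot_left_pos {v w : Pt} (h : v ≠ w) : 0 < dot v w v w := sq_add_sq_pos h

theorem cross_mul_dot_sub (v w x s r : Pt) :
    cross v w x s * dot v w x r - cross v w x r * dot v w x s =
      -(dot v w v w * det2 x s r) := by
  simp only [cross, dot, det2]; ring

theorem det2_eq_of_cross_eq {v w x s : Pt} {t : ℝ} (hvw : v ≠ w)
    (h : cross v w x s - t * dot v w x s = 0) (r : Pt) :
    det2 x s r = dot v w x s / dot v w v w * (cross v w x r - t * dot v w x r) := by
  have := cross_mul_dot_sub v w x s r
  have hpos := dot_left_pos hvw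
  field_simp
  linear_combination this - dot v w x r * h

theorem isPencil_erase {H : Finset Pt} (hH : GenPos H) (hcard : Even H.card) {v w x : Pt}
    (hvw : v ≠ w) (hx : x ∈ H) : IsPencil (H.erase x) (cross v w x) (dot v w x) where
  odd_card := by
    rw [Finset.card_erase_of_mem hx]
    exact Nat.Even.sub_odd (Finset.card_pos.2 ⟨x, hx⟩) hcard odd_one
  ne_zero := by
    intro s hs
    by_contra! h
    have hpos := sq_add_sq_pos (Finset.mem_erase.1 hs).1.symm
    have hpos' := sq_add_sq_pos hvw
    have : cross v w x s ^ 2 + dot v w x s ^ 2 =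
        ((w 0 - v 0) * (w 0 - v 0) + (w 1 - v 1) * (w 1 - v 1)) *
        ((s 0 - x 0) * (s 0 - x 0) + (s 1 - x 1) * (s 1 - x 1)) := by
      simp only [cross, dot]; ring
    rw [h.1, h.2] at this
    have := mul_pos hpos' hpos
    linarith
  det_ne_zero := by
    intro s hs r hr hsr
    rw [Finset.mem_erase] at hs hr
    rw [cross_mul_dot_sub]
    exact neg_ne_zero.2 (mul_ne_zero (dot_left_pos hvw).ne'
      (hH.det2_ne_zero hx hs.2 hr.2 hs.1.symm hr.1.symm hsr))

theorem signSum_eq_zero_iff_halvingEdge {H : Finset Pt} (hH : GenPos H) (hcard : Even H.card)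
    {v w x s : Pt} {t : ℝ} (hvw : v ≠ w) (hx : x ∈ H) (hs : s ∈ H) (hxs : x ≠ s)
    (h : cross v w x s - t * dot v w x s = 0) (hdot : dot v w x s ≠ 0) :
    signSum H (fun r => cross v w x r - t * dot v w x r) = 0 ↔ HalvingEdge H x s := by
  rw [hH.halvingEdge_iff hcard hx hs hxs, funext (det2_eq_of_cross_eq hvw h), signSum_const_mul,
    mul_eq_zero, or_iff_right]
  have : SignType.sign (dot v w x s / dot v w v w) ≠ 0 :=
    sign_ne_zero.2 (div_ne_zero hdot (dot_left_pos hvw).ne')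
  revert this
  generalize SignType.sign (dot v w x s / dot v w v w) = z
  revert z
  decide

/-- Lines that pass within `ε` of `v` and have slope at most `δ` relative to `w - v` separate
the `ε`-neighbourhoods of the points of `S` other than `v` and `w` in the same way as the line
through `v` and `w`, and they include all lines through points `ε`-close to `v` and `w`. -/
structure Separates (S : Finset Pt) (v w : Pt) (δ ε : ℝ) : Prop where
  abs_cross_lt : ∀ x s, dist x v ≤ ε → dist s w ≤ ε → |cross v w x s| < δ * dot v w x s
  sign_eq : ∀ u ∈ S, u ≠ v → u ≠ w → ∀ x s t, dist x v ≤ ε → dist s u ≤ ε → |t| ≤ δ →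
    SignType.sign (cross v w x s - t * dot v w x s) = SignType.sign (det2 v w u)

theorem continuous_cross (v w : Pt) : Continuous fun p : Pt × Pt => cross v w p.1 p.2 := by
  unfold cross; fun_prop

theorem continuous_dot (v w : Pt) : Continuous fun p : Pt × Pt => dot v w p.1 p.2 := by
  unfold dot; fun_prop

theorem eventually_forall_dist_le {P : Pt × Pt → Prop} {x₀ s₀ : Pt} (h : ∀ᶠ p in 𝓝 (x₀, s₀), P p) :
    ∀ᶠ ε : ℝ in 𝓝[>] 0, ∀ x s, dist x x₀ ≤ ε → dist s s₀ ≤ ε → P (x, s) := by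
  obtain ⟨η, hη, hP⟩ := Metric.eventually_nhds_iff.1 h
  filter_upwards [Ioo_mem_nhdsGT hη] with ε hε x s hx hs
  exact hP (by rw [Prod.dist_eq]; exact max_lt (hx.trans_lt hε.2) (hs.trans_lt hε.2))

theorem GenPos.exists_separates {S : Finset Pt} (hS : GenPos S) {v w : Pt} (hv : v ∈ S)
    (hw : w ∈ S) (hvw : v ≠ w) : ∃ δ > 0, ∀ᶠ ε in 𝓝[>] (0 : ℝ), Separates S v w δ ε := by
  obtain ⟨δ, hδu, hδ⟩ : ∃ δ : ℝ, (∀ u ∈ S, u ≠ v → u ≠ w →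
      δ * |dot v w v u| < |det2 v w u|) ∧ 0 < δ := by
    have h : ∀ᶠ δ : ℝ in 𝓝[>] 0, ∀ u ∈ S, u ≠ v → u ≠ w →
        δ * |dot v w v u| < |det2 v w u| := by
      rw [eventually_all_finset]
      intro u hu
      by_cases huv : u = v
      · simp [huv]
      by_cases huw : u = w
      · simp [huw]
      have hc : ContinuousAt (fun δ : ℝ => δ * |dot v w v u|) 0 := by fun_prop
      have hlt : (0 : ℝ) * |dot v w v u| < |det2 v w u| := by
        rw [zero_mul, abs_pos]
        exact hS.det2_ne_zero hv hw hu hvw (Ne.symm huv) (Ne.symm huw)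
      filter_upwards [(hc.eventually_lt_const hlt).filter_mono nhdsWithin_le_nhds] with δ h _ _ using h
    exact (h.and self_mem_nhdsWithin).exists
  refine ⟨δ, hδ, ?_⟩
  have hcross := continuous_cross v w
  have hdot := continuous_dot v w
  have h1 : ∀ᶠ ε : ℝ in 𝓝[>] 0, ∀ x s, dist x v ≤ ε → dist s w ≤ ε →
      |cross v w x s| < δ * dot v w x s := by
    refine eventually_forall_dist_le (P := fun p => |cross v w p.1 p.2| < δ * dot v w p.1 p.2)
      (hcross.abs.continuousAt.eventually_lt (continuous_const.mul hdot).continuousAt ?_)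
    simp only [cross_left_eq_det2, det2_self_right, abs_zero]
    exact mul_pos hδ (dot_left_pos hvw)
  have h2 : ∀ᶠ ε : ℝ in 𝓝[>] 0, ∀ u ∈ S, u ≠ v → u ≠ w → ∀ x s, dist x v ≤ ε → dist s u ≤ ε →
      δ * |dot v w x s| < |cross v w x s| ∧
        SignType.sign (cross v w x s) = SignType.sign (det2 v w u) := by
    rw [eventually_all_finset]
    intro u hu
    by_cases huv : u = v
    · simp [huv]
    by_cases huw : u = w
    · simp [huw]
    have hne := hS.det2_ne_zero hv hw hu hvw (Ne.symm huv) (Ne.symm huw)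
    have e1 : ∀ᶠ p : Pt × Pt in 𝓝 (v, u), δ * |dot v w p.1 p.2| < |cross v w p.1 p.2| :=
      (continuous_const.mul hdot.abs).continuousAt.eventually_lt hcross.abs.continuousAt
        (hδu u hu huv huw)
    have e2 : ∀ᶠ p : Pt × Pt in 𝓝 (v, u),
        SignType.sign (cross v w p.1 p.2) = SignType.sign (det2 v w u) := by
      have hc : ContinuousAt (fun p : Pt × Pt => SignType.sign (cross v w p.1 p.2)) (v, u) :=
        ContinuousAt.comp (f := fun p : Pt × Pt => cross v w p.1 p.2)
          (continuousAt_sign_of_ne_zero hne) hcross.continuousAt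
      exact hc.eventually ((isOpen_discrete {SignType.sign (det2 v w u)}).mem_nhds rfl)
    filter_upwards [eventually_forall_dist_le (e1.and e2)] with ε h _ _ using h
  filter_upwards [h1, h2] with ε h1 h2
  refine ⟨h1, fun u hu huv huw x s t hx hs ht => ?_⟩
  obtain ⟨h3, h4⟩ := h2 u hu huv huw x s hx hs
  rw [← h4]
  have h5 : |t * dot v w x s| < |cross v w x s| := by
    rw [abs_mul]
    exact (mul_le_mul_of_nonneg_right ht (abs_nonneg _)).trans_lt h3
  have h6 := abs_lt.1 h5
  rcases lt_or_ge (cross v w x s) 0 with h | h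
  · rw [abs_of_neg h] at h6
    rw [sign_neg h, sign_neg (by linarith)]
  · rw [abs_of_nonneg h] at h6
    have : 0 < cross v w x s := by linarith
    rw [sign_pos this, sign_pos (by linarith)]

theorem GenPos.exists_forall_separates {S : Finset Pt} (hS : GenPos S) :
    ∃ ε₀ > 0, ∀ v ∈ S, ∀ w ∈ S, v ≠ w → ∃ δ > 0, Separates S v w δ ε₀ := by
  have h : ∀ᶠ ε in 𝓝[>] (0 : ℝ), ∀ v ∈ S, ∀ w ∈ S, v ≠ w → ∃ δ > 0, Separates S v w δ ε := by
    rw [eventually_all_finset]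
    intro v hv
    rw [eventually_all_finset]
    intro w hw
    by_cases hvw : v = w
    · simp [hvw]
    obtain ⟨δ, hδ, h⟩ := hS.exists_separates hv hw hvw
    filter_upwards [h] with ε hε _ using ⟨δ, hδ, hε⟩
  obtain ⟨ε, h, hε⟩ := (h.and self_mem_nhdsWithin).exists
  exact ⟨ε, hε, h⟩

theorem IsFission.mem_of_mem {S H : Finset Pt} {k : ℕ} {ε : ℝ} {cl : Pt → Finset Pt}
    (hH : IsFission S k ε H cl) {v x : Pt} (hv : v ∈ S) (hx : x ∈ cl v) : x ∈ H := by
  rw [← Finset.mem_coe, hH.union_eq]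
  exact Set.mem_biUnion hv hx

theorem IsFission.exists_mem {S H : Finset Pt} {k : ℕ} {ε : ℝ} {cl : Pt → Finset Pt}
    (hH : IsFission S k ε H cl) {x : Pt} (hx : x ∈ H) : ∃ v ∈ S, x ∈ cl v := by
  rw [← Finset.mem_coe, hH.union_eq] at hx
  simpa using hx

theorem IsFission.sum_eq {S H : Finset Pt} {k : ℕ} {ε : ℝ} {cl : Pt → Finset Pt}
    (hH : IsFission S k ε H cl) {M : Type*} [AddCommMonoid M] (f : Pt → M) :
    ∑ s ∈ H, f s = ∑ v ∈ S, ∑ s ∈ cl v, f s := by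
  have h : H = S.biUnion cl := by
    ext x
    rw [Finset.mem_biUnion]
    exact ⟨hH.exists_mem, fun ⟨v, hv, hx⟩ => hH.mem_of_mem hv hx⟩
  rw [h, Finset.sum_biUnion]
  exact fun v hv w hw hvw => hH.disj v hv w hw hvw

theorem IsFission.card_eq {S H : Finset Pt} {k : ℕ} {ε : ℝ} {cl : Pt → Finset Pt}
    (hH : IsFission S k ε H cl) : H.card = S.card * k := by
  rw [Finset.card_eq_sum_ones, hH.sum_eq, ← smul_eq_mul, ← Finset.sum_const]
  exact Finset.sum_congr rfl fun v hv => by rw [← hH.cluster_card v hv, Finset.card_eq_sum_ones]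

/-- The balance of a fission around a line close to `v` and of direction close to `w - v`. -/
theorem IsFission.signSum_eq {S H : Finset Pt} {k : ℕ} {ε : ℝ} {cl : Pt → Finset Pt}
    (hH : IsFission S k ε H cl) {v w x : Pt} {δ t : ℝ} (hsep : Separates S v w δ ε)
    (hv : v ∈ S) (hw : w ∈ S) (hvw : v ≠ w) (hx : x ∈ cl v) (ht : |t| ≤ δ) :
    signSum H (fun s => cross v w x s - t * dot v w x s) =
      signSum (cl v) (fun s => cross v w x s - t * dot v w x s) +
      signSum (cl w) (fun s => cross v w x s - t * dot v w x s) +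
      k * signSum S (det2 v w) := by
  have hw' : w ∈ S.erase v := Finset.mem_erase.2 ⟨hvw.symm, hw⟩
  rw [← signSum_erase (det2_self_left v w), ← signSum_erase (det2_self_right v w)]
  unfold signSum
  rw [hH.sum_eq, ← Finset.add_sum_erase _ _ hv, ← Finset.add_sum_erase _ _ hw', ← add_assoc,
    Finset.mul_sum]
  congr 1
  refine Finset.sum_congr rfl fun u hu => ?_
  simp only [Finset.mem_erase] at hu
  rw [Finset.sum_congr rfl fun s hs => by
    rw [hsep.sign_eq u hu.2.2 hu.2.1 hu.1 x s t (hH.close v hv x hx)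
      (hH.close u hu.2.2 s hs) ht]]
  rw [Finset.sum_const, hH.cluster_card u hu.2.2, nsmul_eq_mul]

theorem abs_signSum_lt_card {ι : Type*} {F : Finset ι} {f : ι → ℝ} {x : ι} (hx : x ∈ F)
    (h : f x = 0) : |signSum F f| < F.card := by
  classical
  rw [← signSum_erase h, ← Finset.card_erase_add_one hx]
  have := abs_signSum_le_card (F.erase x) f
  push_cast
  omega

/-- The parameter of the line through `x` and `q`. -/
theorem Separates.exists_param {S : Finset Pt} {v w x q : Pt} {δ ε : ℝ}
    (hsep : Separates S v w δ ε) (hδ : 0 < δ) (hx : dist x v ≤ ε) (hq : dist q w ≤ ε) :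
    0 < dot v w x q ∧ ∃ t, |t| ≤ δ ∧ cross v w x q - t * dot v w x q = 0 := by
  have h := hsep.abs_cross_lt x q hx hq
  have hdot : 0 < dot v w x q := pos_of_mul_pos_right ((abs_nonneg _).trans_lt h) hδ.le
  refine ⟨hdot, cross v w x q / dot v w x q, ?_, by field_simp; simp⟩
  rw [abs_div, abs_of_pos hdot, div_le_iff₀ hdot]
  exact h.le

theorem IsFission.halvingEdge_of_halvingEdge {S H : Finset Pt} {k : ℕ} {ε : ℝ}
    {cl : Pt → Finset Pt} (hH : IsFission S k ε H cl) (hS : GenPos S) (hcard : Even S.card)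
    {v w x q : Pt} {δ : ℝ} (hδ : 0 < δ) (hsep : Separates S v w δ ε)
    (hv : v ∈ S) (hw : w ∈ S) (hvw : v ≠ w) (hx : x ∈ cl v) (hq : q ∈ cl w)
    (h : HalvingEdge H x q) : HalvingEdge S v w := by
  obtain ⟨hdot, t, ht, h0⟩ := hsep.exists_param hδ (hH.close v hv x hx) (hH.close w hw q hq)
  have hsum := (signSum_eq_zero_iff_halvingEdge hH.genPos (hH.card_eq ▸ hcard.mul_right k) hvw
    (hH.mem_of_mem hv hx) (hH.mem_of_mem hw hq) h.2.2.1 h0 hdot.ne').2 h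
  rw [hH.signSum_eq hsep hv hw hvw hx ht] at hsum
  have hV := abs_lt.1 (abs_signSum_lt_card (f := fun s => cross v w x s - t * dot v w x s) hx
    (by simp [cross_point_self, dot_point_self]))
  have hW := abs_lt.1 (abs_signSum_lt_card (f := fun s => cross v w x s - t * dot v w x s) hq h0)
  rw [hH.cluster_card v hv] at hV
  rw [hH.cluster_card w hw] at hW
  rw [hS.halvingEdge_iff hcard hv hw hvw]
  obtain ⟨m, hm⟩ := hS.even_signSum hcard hv hw hvw
  rw [hm] at hsum ⊢
  have h1 : m < 1 := by
    by_contra! hge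
    nlinarith
  have h2 : -1 < m := by
    by_contra! hge
    nlinarith
  omega

theorem IsFission.existsUnique_halvingEdge {S H : Finset Pt} {k : ℕ} {ε : ℝ}
    {cl : Pt → Finset Pt} (hH : IsFission S k ε H cl) (hplain : IsPlain S H cl) (hS : GenPos S)
    (hcard : Even S.card) {v w x : Pt} {δ : ℝ} (hδ : 0 < δ) (hsep : Separates S v w δ ε)
    (hv : v ∈ S) (hw : w ∈ S) (hvw : v ≠ w) (hx : x ∈ cl v) (h : HalvingEdge S v w) :
    ∃! q, q ∈ cl w ∧ HalvingEdge H x q := by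
  have hxH := hH.mem_of_mem hv hx
  have hcardH : Even H.card := hH.card_eq ▸ hcard.mul_right k
  have hF := isPencil_erase hH.genPos hcardH hvw hxH
  have herase (t : ℝ) : signSum (H.erase x) (fun s => cross v w x s - t * dot v w x s) =
      signSum H (fun s => cross v w x s - t * dot v w x s) :=
    signSum_erase (by simp [cross_point_self, dot_point_self])
  have hxw : ∀ q ∈ cl w, x ≠ q := by
    rintro q hq rfl
    exact Finset.disjoint_left.1 (hH.disj v hv w hw hvw) hx hq
  have hdot : ∀ q ∈ cl w, 0 < dot v w x q := fun q hq =>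
    (hsep.exists_param hδ (hH.close v hv x hx) (hH.close w hw q hq)).1
  have hzero : ∀ t, |t| ≤ δ → signSum (H.erase x) (fun s => cross v w x s - t * dot v w x s) = 0 →
      ∃ q ∈ cl w, cross v w x q - t * dot v w x q = 0 ∧ HalvingEdge H x q := by
    intro t ht h0
    obtain ⟨s, hs, hst⟩ := hF.exists_eq_zero h0
    have hsdot := (hF.eventually_eq_of_eq_zero hs hst).1
    rw [Finset.mem_erase] at hs
    have hedge := (signSum_eq_zero_iff_halvingEdge hH.genPos hcardH hvw hxH hs.2 hs.1.symm hst
      hsdot).1 (herase t ▸ h0)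
    obtain ⟨u, hu, hsu⟩ := hH.exists_mem hs.2
    have huv : u ≠ v := by
      rintro rfl
      exact hplain u hu x hx s hsu hedge
    have huw : u = w := by
      by_contra huw
      have := hsep.sign_eq u hu huv huw x s t (hH.close v hv x hx) (hH.close u hu s hsu) ht
      rw [hst, sign_zero, eq_comm, sign_eq_zero_iff] at this
      exact hS.det2_ne_zero hv hw hu hvw huv.symm (Ne.symm huw) this
    exact ⟨s, huw ▸ hsu, hst, hedge⟩
  have hbalance := (hS.halvingEdge_iff hcard hv hw hvw).1 h
  have hV (t : ℝ) := abs_lt.1 (abs_signSum_lt_card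
    (f := fun s => cross v w x s - t * dot v w x s) hx (by simp [cross_point_self, dot_point_self]))
  rw [hH.cluster_card v hv] at hV
  have hlow : 0 < signSum (H.erase x) (fun s => cross v w x s - (-δ) * dot v w x s) := by
    rw [herase, hH.signSum_eq hsep hv hw hvw hx (by rw [abs_neg, abs_of_pos hδ]), hbalance,
      signSum_of_pos (F := cl w), hH.cluster_card w hw]
    · linarith [(hV (-δ)).1]
    · intro q hq
      have := abs_lt.1 (hsep.abs_cross_lt x q (hH.close v hv x hx) (hH.close w hw q hq))
      linarith [this.1]
  have hhigh : signSum (H.erase x) (fun s => cross v w x s - δ * dot v w x s) < 0 := by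
    rw [herase, hH.signSum_eq hsep hv hw hvw hx (abs_of_pos hδ).le, hbalance,
      signSum_of_neg (F := cl w), hH.cluster_card w hw]
    · linarith [(hV δ).2]
    · intro q hq
      have := abs_lt.1 (hsep.abs_cross_lt x q (hH.close v hv x hx) (hH.close w hw q hq))
      linarith [this.2]
  obtain ⟨t, ht, ht0⟩ := hF.exists_signSum_eq_zero (by linarith) hlow hhigh
  obtain ⟨q, hq, hqt, hedge⟩ := hzero t (abs_le.2 ht) ht0
  refine ⟨q, ⟨hq, hedge⟩, ?_⟩
  rintro r ⟨hr, hredge⟩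
  obtain ⟨-, t', ht', hrt⟩ := hsep.exists_param hδ (hH.close v hv x hx) (hH.close w hw r hr)
  have ht'0 := herase t' ▸ (signSum_eq_zero_iff_halvingEdge hH.genPos hcardH hvw hxH
    (hH.mem_of_mem hw hr) (hxw r hr) hrt (hdot r hr).ne').2 hredge
  have hunique : ∀ c d, -δ ≤ c → d ≤ δ →
      signSum (H.erase x) (fun s => cross v w x s - c * dot v w x s) = 0 →
      signSum (H.erase x) (fun s => cross v w x s - d * dot v w x s) = 0 → ¬ c < d := by
    intro c d hc hd
    refine hF.not_lt_of_signSum_eq_zero fun τ hτ h0 => ?_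
    obtain ⟨s, hs, hsτ, -⟩ := hzero τ (abs_le.2 ⟨hc.trans hτ.1, hτ.2.trans hd⟩) h0
    exact ⟨s, Finset.mem_erase.2 ⟨(hxw s hs).symm, hH.mem_of_mem hw hs⟩, hsτ, hdot s hs⟩
  have htt' : t = t' := le_antisymm
    (not_lt.1 (hunique t' t (abs_le.1 ht').1 ht.2 ht'0 ht0))
    (not_lt.1 (hunique t t' ht.1 (abs_le.1 ht').2 ht0 ht'0))
  subst htt'
  by_contra hrq
  refine hF.det_ne_zero r (Finset.mem_erase.2 ⟨(hxw r hr).symm, hH.mem_of_mem hw hr⟩) q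
    (Finset.mem_erase.2 ⟨(hxw q hq).symm, hH.mem_of_mem hw hq⟩) hrq ?_
  linear_combination dot v w x q * hrt - dot v w x r * hqt

theorem stmt9 (S : Finset Pt) (hS : GenPos S) (hcard : Even S.card)
    (k : ℕ) (hk : 1 ≤ k) :
    ∃ ε₀ > 0, ∀ ε : ℝ, 0 < ε → ε ≤ ε₀ →
      ∀ (H : Finset Pt) (cl : Pt → Finset Pt), IsFission S k ε H cl → IsPlain S H cl →
        ∀ v ∈ S, ∀ x ∈ cl v, ∀ w ∈ S, w ≠ v →
          (HalvingEdge S v w → ∃! q, q ∈ cl w ∧ HalvingEdge H x q) ∧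
          (¬ HalvingEdge S v w → ∀ q ∈ cl w, ¬ HalvingEdge H x q) := by
  obtain ⟨ε₀, hε₀, hsep⟩ := hS.exists_forall_separates
  refine ⟨ε₀, hε₀, fun ε _ hε H cl hH hplain v hv x hx w hw hwv => ?_⟩
  replace hH : IsFission S k ε₀ H cl :=
    { hH with close := fun v hv x hx => (hH.close v hv x hx).trans hε }
  obtain ⟨δ, hδ, hsep⟩ := hsep v hv w hw hwv.symm
  exact ⟨hH.existsUnique_halvingEdge hplain hS hcard hδ hsep hv hw hwv.symm hx,
    fun h q hq hedge =>
      h (hH.halvingEdge_of_halvingEdge hS hcard hδ hsep hv hw hwv.symm hx hq hedge)⟩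

end
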